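/- Fix an odd integer n ≥ 3. There exists a constant C = C(n) > 0 such that the following holds. Let q be an odd prime power and let M, N be invertible symmetric n×n matrices over F_q such that N is not a scalar multiple of M, and set f(v) = vᵀMv, g(v) = vᵀNv. Then the number of nonzero vectors v ∈ F_q^n such that (−1)^{(n−1)/2}·det(M)·f(v) is a nonzero square in F_q and (−1)^{(n−1)/2}·det(N)·g(v) is a nonzero square in F_q satisfies |count − (q−1)·q^{n−1}/4| ≤ C·(q−1)·q^{n−3/2}. (Equivalently, the number of points P ∈ P^{n−1}(F_q) external to {f=0} and external to {g=0} is q^{n−1}/4 + O(q^{n−3/2}).) -/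

import Mathlib

open Matrix

section QuadraticExponentialSums

variable {F ι : Type*} [Field F] [Fintype F] [Fintype ι] [DecidableEq ι]

/-- The exponential sum `∑ v, ψ (vᵀ A v)` attached to the quadratic form of `A`. -/
noncomputable def quadExpSum (ψ : AddChar F ℂ) (A : Matrix ι ι F) : ℂ :=
  ∑ v : ι → F, ψ (v ⬝ᵥ A *ᵥ v)

lemma AddChar.sum_dotProduct [DecidableEq F] {ψ : AddChar F ℂ}
    (hψ : ψ.IsPrimitive) (x : ι → F) :
    ∑ w : ι → F, ψ (w ⬝ᵥ x) = if x = 0 then (Fintype.card F : ℂ) ^ Fintype.card ι else 0 := by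
  have h : ∑ w : ι → F, ψ (w ⬝ᵥ x) = ∏ i, ∑ a : F, ψ (a * x i) := by
    rw [Finset.prod_univ_sum, Fintype.piFinset_univ]
    refine Finset.sum_congr rfl fun w _ ↦ ?_
    exact map_prod ψ.toMonoidHom (fun i ↦ Multiplicative.ofAdd (w i * x i)) Finset.univ
  simp_rw [h, AddChar.sum_mulShift _ hψ]
  split_ifs with hx
  · simp [hx]
  · obtain ⟨i, hi⟩ := Function.ne_iff.1 hx
    exact Finset.prod_eq_zero (Finset.mem_univ i) (by simpa using hi)

lemma quadExpSum_normSq_le [DecidableEq F] (h2 : (2 : F) ≠ 0) {ψ : AddChar F ℂ}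
    (hψ : ψ.IsPrimitive) {A : Matrix ι ι F} (hA : A.IsSymm) :
    ‖quadExpSum ψ A‖ ^ 2 ≤ (Fintype.card F : ℝ) ^ Fintype.card ι *
      (Finset.univ.filter fun h : ι → F ↦ A *ᵥ h = 0).card := by
  have key : quadExpSum ψ A * (starRingEnd ℂ) (quadExpSum ψ A) =
      ∑ h : ι → F, if A *ᵥ h = 0 then
        ψ (h ⬝ᵥ A *ᵥ h) * (Fintype.card F : ℂ) ^ Fintype.card ι else 0 := by
    have hsymm (h w : ι → F) : h ⬝ᵥ A *ᵥ w = w ⬝ᵥ A *ᵥ h := by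
      rw [dotProduct_mulVec, ← mulVec_transpose, hA.eq, dotProduct_comm]
    simp_rw [quadExpSum, map_sum, Finset.sum_mul_sum]
    rw [Finset.sum_comm]
    simp_rw [← AddChar.map_neg_eq_conj, ← AddChar.map_add_eq_mul]
    have (w : ι → F) : ∑ v : ι → F, ψ (v ⬝ᵥ A *ᵥ v + -(w ⬝ᵥ A *ᵥ w)) =
        ∑ h : ι → F, ψ (h ⬝ᵥ A *ᵥ h) * ψ (w ⬝ᵥ (2 : F) • A *ᵥ h) := by
      rw [← Equiv.sum_comp (Equiv.addRight w)]
      refine Finset.sum_congr rfl fun h _ ↦ ?_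
      rw [← AddChar.map_add_eq_mul]
      congr 1
      simp only [Equiv.coe_addRight, mulVec_add, dotProduct_add, add_dotProduct, hsymm h w,
        dotProduct_smul, smul_eq_mul]
      ring
    simp_rw [this]
    rw [Finset.sum_comm]
    simp_rw [← Finset.mul_sum, AddChar.sum_dotProduct hψ]
    refine Finset.sum_congr rfl fun h _ ↦ ?_
    simp [h2]
  have := congrArg norm key
  rw [norm_mul, RCLike.norm_conj, ← sq] at this
  rw [this, ← Finset.sum_filter]
  refine (norm_sum_le _ _).trans (le_of_eq ?_)
  simp [AddChar.norm_apply, mul_comm]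

lemma norm_quadExpSum_le_of_isUnit (h2 : (2 : F) ≠ 0) {ψ : AddChar F ℂ}
    (hψ : ψ.IsPrimitive) {A : Matrix ι ι F} (hA : A.IsSymm) (hdet : IsUnit A.det) :
    ‖quadExpSum ψ A‖ ≤ √(Fintype.card F) ^ Fintype.card ι := by
  classical
  have h := quadExpSum_normSq_le h2 hψ hA
  have hker : (Finset.univ.filter fun h : ι → F ↦ A *ᵥ h = 0) = {0} := by
    ext h
    simp only [Finset.mem_filter_univ, Finset.mem_singleton]
    exact ⟨fun hh ↦ eq_zero_of_mulVec_eq_zero hdet.ne_zero hh, fun hh ↦ by simp [hh]⟩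
  rw [hker, Finset.card_singleton, Nat.cast_one, mul_one] at h
  refine le_of_sq_le_sq ?_ (by positivity)
  rwa [← pow_mul, mul_comm _ 2, pow_mul, Real.sq_sqrt (by positivity)]

lemma norm_quadExpSum_le_of_ne_zero (h2 : (2 : F) ≠ 0) {ψ : AddChar F ℂ}
    (hψ : ψ.IsPrimitive) {A : Matrix ι ι F} (hA : A.IsSymm) (hA0 : A ≠ 0) :
    ‖quadExpSum ψ A‖ ≤ √(Fintype.card F) ^ (2 * Fintype.card ι - 1) := by
  classical
  have h := quadExpSum_normSq_le h2 hψ hA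
  have hlt : LinearMap.ker A.mulVecLin ≠ ⊤ := by
    rwa [Ne, LinearMap.ker_eq_top, ← toLin'_apply', map_eq_zero_iff _ toLin'.injective]
  have hfin := Submodule.finrank_lt hlt
  rw [Module.finrank_fintype_fun_eq_card] at hfin
  have hcard : (Finset.univ.filter fun h : ι → F ↦ A *ᵥ h = 0).card ≤
      Fintype.card F ^ (Fintype.card ι - 1) := by
    rw [← Fintype.card_subtype, Fintype.card_congr (Equiv.subtypeEquivRight
      (q := (· ∈ LinearMap.ker A.mulVecLin)) fun h ↦ by simp),
      Module.card_eq_pow_finrank (K := F) (V := LinearMap.ker A.mulVecLin)]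
    exact Nat.pow_le_pow_right Fintype.card_pos (by omega)
  have hcard' : ((Finset.univ.filter fun h : ι → F ↦ A *ᵥ h = 0).card : ℝ) ≤
      (Fintype.card F : ℝ) ^ (Fintype.card ι - 1) := by exact_mod_cast hcard
  refine le_of_sq_le_sq ?_ (by positivity)
  rw [← pow_mul, mul_comm _ 2, pow_mul, Real.sq_sqrt (by positivity)]
  refine h.trans ((mul_le_mul_of_nonneg_left hcard' (by positivity)).trans ?_)
  rw [← pow_add]
  exact (congrArg _ (by omega)).le

lemma quadExpSum_zero (ψ : AddChar F ℂ) :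
    quadExpSum ψ (0 : Matrix ι ι F) = (Fintype.card F : ℂ) ^ Fintype.card ι := by
  simp [quadExpSum]

/-- The complex-valued quadratic character. -/
noncomputable def quadCharC (F : Type*) [Field F] [Fintype F] : MulChar F ℂ :=
  open Classical in (quadraticChar F).ringHomComp (Int.castRingHom ℂ)

lemma quadCharC_apply [DecidableEq F] (x : F) : quadCharC F x = (quadraticChar F x : ℂ) := by
  simp only [quadCharC, MulChar.ringHomComp_apply, eq_intCast]
  congr!

lemma quadCharC_ne_one (h2 : ringChar F ≠ 2) : quadCharC F ≠ 1 := by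
  classical
  exact (MulChar.ringHomComp_ne_one_iff Int.cast_injective).2 (quadraticChar_ne_one h2)

lemma quadCharC_isQuadratic : (quadCharC F).IsQuadratic := by
  classical
  exact (quadraticChar_isQuadratic F).comp _

lemma norm_quadCharC_le (x : F) : ‖quadCharC F x‖ ≤ 1 := by
  rcases quadCharC_isQuadratic x with h | h | h <;> simp [h]

lemma norm_gaussSum_quadCharC (h2 : ringChar F ≠ 2) {ψ : AddChar F ℂ} (hψ : ψ.IsPrimitive) :
    ‖gaussSum (quadCharC F) ψ‖ = √(Fintype.card F) := by
  have h := congrArg norm (gaussSum_sq (quadCharC_ne_one h2) quadCharC_isQuadratic hψ)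
  have h1 : ‖quadCharC F (-1)‖ = 1 := by
    rcases quadCharC_isQuadratic (F := F) (-1) with h | h | h
    · exact absurd h ((isUnit_one.neg).map (quadCharC F)).ne_zero
    · simp [h]
    · simp [h]
  rw [norm_pow, norm_mul, h1, one_mul, Complex.norm_natCast] at h
  rw [← h, Real.sqrt_sq (norm_nonneg _)]

lemma sum_quadCharC_mul (h2 : ringChar F ≠ 2) (ψ : AddChar F ℂ) (x : F) :
    ∑ s, quadCharC F s * ψ (s * x) = quadCharC F x * gaussSum (quadCharC F) ψ := by
  rcases eq_or_ne x 0 with rfl | hx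
  · simp [MulChar.sum_eq_zero_of_ne_one (quadCharC_ne_one h2),
      MulChar.map_zero]
  · have h := gaussSum_mulShift (quadCharC F) ψ (Units.mk0 x hx)
    have hsq : quadCharC F x * quadCharC F x = 1 := by
      rw [← sq, ← MulChar.pow_apply' _ two_ne_zero, quadCharC_isQuadratic.sq_eq_one,
        MulChar.one_apply hx.isUnit]
    rw [Units.val_mk0] at h
    rw [← h, ← mul_assoc, hsq, one_mul]
    simp [gaussSum, AddChar.mulShift_apply, mul_comm]

lemma card_det_smul_add_eq_zero_le [DecidableEq F] {M : Matrix ι ι F} (hM : IsUnit M.det)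
    (N : Matrix ι ι F) :
    (Finset.univ.filter fun s : F ↦ (s • M + N).det = 0).card ≤ Fintype.card ι := by
  set p := (-(M⁻¹ * N)).charpoly with hp
  have hp0 : p ≠ 0 := (charpoly_monic _).ne_zero
  have hsub : (Finset.univ.filter fun s : F ↦ (s • M + N).det = 0) ⊆ p.roots.toFinset := by
    intro s hs
    rw [Finset.mem_filter_univ] at hs
    rw [Multiset.mem_toFinset, Polynomial.mem_roots hp0, Polynomial.IsRoot, hp, eval_charpoly]
    have h : s • M + N = M * (scalar ι s - -(M⁻¹ * N)) := by
      rw [sub_neg_eq_add, Matrix.mul_add, mul_nonsing_inv_cancel_left _ _ hM, scalar_apply,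
        ← smul_one_eq_diagonal, Matrix.mul_smul, Matrix.mul_one]
    rw [h, det_mul] at hs
    exact (mul_eq_zero.1 hs).resolve_left hM.ne_zero
  calc _ ≤ _ := Finset.card_le_card hsub
    _ ≤ _ := Multiset.toFinset_card_le _
    _ ≤ _ := p.card_roots'
    _ = _ := charpoly_natDegree_eq_dim _

/-- The quadratic form of `s • M` as an exponential sum: `∑ v, ψ (s f(v))`. -/
lemma quadExpSum_smul (ψ : AddChar F ℂ) (M : Matrix ι ι F) (s : F) :
    quadExpSum ψ (s • M) = ∑ v : ι → F, ψ (s * (v ⬝ᵥ M *ᵥ v)) := by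
  simp [quadExpSum, smul_mulVec]

lemma quadExpSum_smul_add_smul (ψ : AddChar F ℂ) (M N : Matrix ι ι F) (s t : F) :
    quadExpSum ψ (s • M + t • N) =
      ∑ v : ι → F, ψ (s * (v ⬝ᵥ M *ᵥ v)) * ψ (t * (v ⬝ᵥ N *ᵥ v)) := by
  simp [quadExpSum, add_mulVec, smul_mulVec, AddChar.map_add_eq_mul]

lemma sqrt_card_pos : 0 < √(Fintype.card F : ℝ) :=
  Real.sqrt_pos.2 (by exact_mod_cast Fintype.card_pos)

lemma one_le_sqrt_card : 1 ≤ √(Fintype.card F : ℝ) :=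
  Real.one_le_sqrt.2 (by exact_mod_cast Fintype.card_pos)

lemma card_eq_sqrt_card_sq : (Fintype.card F : ℝ) = √(Fintype.card F : ℝ) ^ 2 :=
  (Real.sq_sqrt (by positivity)).symm

lemma isUnit_det_smul {K : Type*} [Field K] {M : Matrix ι ι K} (hM : IsUnit M.det) {s : K}
    (hs : s ≠ 0) :
    IsUnit (s • M).det := by
  rw [det_smul]
  exact (hs.isUnit.pow _).mul hM

lemma norm_sum_quadCharC_le (h2 : ringChar F ≠ 2) {ψ : AddChar F ℂ} (hψ : ψ.IsPrimitive)
    (hι : 2 ≤ Fintype.card ι) {M : Matrix ι ι F} (hM : M.IsSymm) (hdet : IsUnit M.det) :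
    ‖∑ v : ι → F, quadCharC F (v ⬝ᵥ M *ᵥ v)‖ ≤
      √(Fintype.card F) ^ (2 * Fintype.card ι - 1) := by
  set r := √(Fintype.card F : ℝ) with hr
  have key : (∑ v : ι → F, quadCharC F (v ⬝ᵥ M *ᵥ v)) * gaussSum (quadCharC F) ψ =
      ∑ s, quadCharC F s * quadExpSum ψ (s • M) := by
    simp_rw [Finset.sum_mul, ← sum_quadCharC_mul h2, quadExpSum_smul, Finset.mul_sum]
    exact Finset.sum_comm
  have hterm (s : F) : ‖quadCharC F s * quadExpSum ψ (s • M)‖ ≤ r ^ Fintype.card ι := by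
    rcases eq_or_ne s 0 with rfl | hs
    · rw [MulChar.map_zero, zero_mul, norm_zero]
      positivity
    · rw [norm_mul]
      exact (mul_le_of_le_one_left (norm_nonneg _) (norm_quadCharC_le s)).trans
        (norm_quadExpSum_le_of_isUnit (Ring.two_ne_zero h2) hψ (hM.smul s)
          (isUnit_det_smul hdet hs))
  have h := congrArg norm key
  rw [norm_mul, norm_gaussSum_quadCharC h2 hψ, ← hr] at h
  refine le_of_mul_le_mul_right ?_ (sqrt_card_pos (F := F))
  rw [← hr, h]
  calc _ ≤ ∑ s : F, r ^ Fintype.card ι := norm_sum_le_of_le Finset.univ fun s _ ↦ hterm s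
    _ = r ^ (Fintype.card ι + 2) := by
      rw [Finset.sum_const, Finset.card_univ, nsmul_eq_mul, card_eq_sqrt_card_sq, ← hr]; ring
    _ ≤ r ^ (2 * Fintype.card ι - 1 + 1) := pow_le_pow_right₀ one_le_sqrt_card (by omega)
    _ = _ := pow_succ _ _

lemma norm_sum_quadCharC_mul_le (h2 : ringChar F ≠ 2) {ψ : AddChar F ℂ} (hψ : ψ.IsPrimitive)
    (hι : 3 ≤ Fintype.card ι) {M N : Matrix ι ι F} (hM : M.IsSymm) (hN : N.IsSymm)
    (hdet : IsUnit M.det) (hMN : ∀ c : F, N ≠ c • M) :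
    ‖∑ v : ι → F, quadCharC F (v ⬝ᵥ M *ᵥ v) * quadCharC F (v ⬝ᵥ N *ᵥ v)‖ ≤
      (Fintype.card ι + 1) * √(Fintype.card F) ^ (2 * Fintype.card ι - 1) := by
  classical
  set r := √(Fintype.card F : ℝ) with hr
  set m := Fintype.card ι with hm
  have hr0 : 0 < r := sqrt_card_pos
  set G := gaussSum (quadCharC F) ψ with hG
  have key : (∑ v : ι → F, quadCharC F (v ⬝ᵥ M *ᵥ v) * quadCharC F (v ⬝ᵥ N *ᵥ v)) * G ^ 2 =
      ∑ t, ∑ s, quadCharC F t * (quadCharC F s * quadExpSum ψ (s • M + t • N)) := by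
    have hv (v : ι → F) : quadCharC F (v ⬝ᵥ M *ᵥ v) * quadCharC F (v ⬝ᵥ N *ᵥ v) * G ^ 2 =
        ∑ t, ∑ s, quadCharC F t * (quadCharC F s *
          (ψ (s * (v ⬝ᵥ M *ᵥ v)) * ψ (t * (v ⬝ᵥ N *ᵥ v)))) := by
      calc _ = (quadCharC F (v ⬝ᵥ N *ᵥ v) * G) * (quadCharC F (v ⬝ᵥ M *ᵥ v) * G) := by ring
        _ = _ := by
          rw [hG, ← sum_quadCharC_mul h2, ← sum_quadCharC_mul h2, Finset.sum_mul_sum]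
          exact Finset.sum_congr rfl fun t _ ↦ Finset.sum_congr rfl fun s _ ↦ by ring
    simp_rw [Finset.sum_mul, hv, quadExpSum_smul_add_smul, Finset.mul_sum]
    rw [Finset.sum_comm]
    exact Finset.sum_congr rfl fun t _ ↦ Finset.sum_comm
  have hterm (t s : F) : ‖quadCharC F t * (quadCharC F s * quadExpSum ψ (s • M + t • N))‖ ≤
      r ^ m + if (s • M + t • N).det = 0 then r ^ (2 * m - 1) else 0 := by
    rcases eq_or_ne t 0 with rfl | ht
    · rw [MulChar.map_zero, zero_mul, norm_zero]
      positivity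
    have hle : ‖quadCharC F t * (quadCharC F s * quadExpSum ψ (s • M + t • N))‖ ≤
        ‖quadExpSum ψ (s • M + t • N)‖ := by
      rw [norm_mul, norm_mul]
      exact (mul_le_of_le_one_left (by positivity) (norm_quadCharC_le t)).trans
        (mul_le_of_le_one_left (by positivity) (norm_quadCharC_le s))
    refine hle.trans ?_
    have hsymm : (s • M + t • N).IsSymm := (hM.smul s).add (hN.smul t)
    split_ifs with hd
    · refine (norm_quadExpSum_le_of_ne_zero (Ring.two_ne_zero h2) hψ hsymm fun h0 ↦ ?_).trans
        (le_add_of_nonneg_left (by positivity))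
      refine hMN (-(t⁻¹ * s)) ?_
      rw [neg_smul, mul_smul, ← smul_neg, eq_inv_smul_iff₀ ht]
      exact eq_neg_of_add_eq_zero_right h0
    · rw [add_zero]
      exact norm_quadExpSum_le_of_isUnit (Ring.two_ne_zero h2) hψ hsymm (isUnit_iff_ne_zero.2 hd)
  have hinner (t : F) :
      ∑ s : F, (r ^ m + if (s • M + t • N).det = 0 then r ^ (2 * m - 1) else 0) ≤
        r ^ (m + 2) + m * r ^ (2 * m - 1) := by
    rw [Finset.sum_add_distrib, ← Finset.sum_filter, Finset.sum_const, Finset.sum_const,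
      Finset.card_univ, nsmul_eq_mul, nsmul_eq_mul, card_eq_sqrt_card_sq, ← hr, ← pow_add,
      add_comm 2]
    gcongr
    exact card_det_smul_add_eq_zero_le hdet _
  have h := congrArg norm key
  rw [norm_mul, norm_pow, norm_gaussSum_quadCharC h2 hψ, ← hr] at h
  refine le_of_mul_le_mul_right ?_ (pow_pos hr0 2)
  rw [h]
  refine (norm_sum_le_of_le Finset.univ
    fun t _ ↦ norm_sum_le_of_le Finset.univ fun s _ ↦ hterm t s).trans ?_
  calc
    _ ≤ ∑ _t : F, (r ^ (m + 2) + m * r ^ (2 * m - 1)) := Finset.sum_le_sum fun t _ ↦ hinner t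
    _ = (r ^ (m + 2) + m * r ^ (2 * m - 1)) * r ^ 2 := by
      rw [Finset.sum_const, Finset.card_univ, nsmul_eq_mul, card_eq_sqrt_card_sq, ← hr, mul_comm]
    _ ≤ (r ^ (2 * m - 1) + m * r ^ (2 * m - 1)) * r ^ 2 := by
      gcongr
      · exact one_le_sqrt_card
      · omega
    _ = _ := by ring

lemma card_quadForm_eq_zero_le [DecidableEq F] (h2 : ringChar F ≠ 2) {ψ : AddChar F ℂ}
    (hψ : ψ.IsPrimitive) (hι : 1 ≤ Fintype.card ι) {M : Matrix ι ι F} (hM : M.IsSymm)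
    (hdet : IsUnit M.det) :
    ((Finset.univ.filter fun v : ι → F ↦ v ⬝ᵥ M *ᵥ v = 0).card : ℝ) ≤
      2 * √(Fintype.card F) ^ (2 * Fintype.card ι - 1) := by
  set r := √(Fintype.card F : ℝ) with hr
  have hr0 : 0 < r := sqrt_card_pos
  have hr1 : 1 ≤ r := one_le_sqrt_card
  set Z := (Finset.univ.filter fun v : ι → F ↦ v ⬝ᵥ M *ᵥ v = 0).card
  have key : (Z : ℂ) * Fintype.card F = ∑ s : F, quadExpSum ψ (s • M) := by
    simp_rw [quadExpSum_smul]
    rw [Finset.sum_comm]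
    simp_rw [AddChar.sum_mulShift _ hψ]
    simp [← Finset.sum_filter, Z]
  have hterm (s : F) : ‖quadExpSum ψ (s • M)‖ ≤
      r ^ Fintype.card ι + if s = 0 then r ^ (2 * Fintype.card ι) else 0 := by
    split_ifs with hs
    · rw [hs, zero_smul, quadExpSum_zero, norm_pow, Complex.norm_natCast, card_eq_sqrt_card_sq,
        ← hr, ← pow_mul]
      exact le_add_of_nonneg_left (by positivity)
    · rw [add_zero]
      exact norm_quadExpSum_le_of_isUnit (Ring.two_ne_zero h2) hψ (hM.smul s)
        (isUnit_det_smul hdet hs)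
  have h := congrArg norm key
  rw [norm_mul, Complex.norm_natCast, Complex.norm_natCast, card_eq_sqrt_card_sq, ← hr] at h
  refine le_of_mul_le_mul_right ?_ (pow_pos hr0 2)
  rw [h]
  refine (norm_sum_le_of_le Finset.univ fun s _ ↦ hterm s).trans ?_
  calc
    _ = r ^ (Fintype.card ι + 2) + r ^ (2 * Fintype.card ι) := by
      rw [Finset.sum_add_distrib, Finset.sum_const, Finset.card_univ, nsmul_eq_mul,
        card_eq_sqrt_card_sq, ← hr, Finset.sum_ite_eq']
      simp
      ring
    _ ≤ r ^ (2 * Fintype.card ι - 1 + 2) + r ^ (2 * Fintype.card ι - 1 + 2) := by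
      gcongr <;> first | exact hr1 | omega
    _ = _ := by ring

/-- The indicator of `x` and `y` both being nonzero squares, expanded in quadratic characters. -/
lemma norm_indicator_isSquare_sub_le [DecidableEq F] (x y : F) :
    ‖(4 * (if (IsSquare x ∧ x ≠ 0) ∧ IsSquare y ∧ y ≠ 0 then 1 else 0) -
        (1 + quadCharC F x + quadCharC F y + quadCharC F x * quadCharC F y) : ℂ)‖ ≤
      2 * ((if x = 0 then 1 else 0) + if y = 0 then 1 else 0) := by
  classical
  have hcases (z : F) : (z = 0 ∧ quadCharC F z = 0) ∨
      (z ≠ 0 ∧ IsSquare z ∧ quadCharC F z = 1) ∨ (z ≠ 0 ∧ ¬ IsSquare z ∧ quadCharC F z = -1) := by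
    rcases eq_or_ne z 0 with rfl | hz
    · exact Or.inl ⟨rfl, MulChar.map_zero _⟩
    · by_cases hs : IsSquare z
      · exact Or.inr (Or.inl ⟨hz, hs,
          by simp [quadCharC_apply, -quadraticChar_apply, (quadraticChar_one_iff_isSquare hz).2 hs]⟩)
      · exact Or.inr (Or.inr ⟨hz, hs,
          by simp [quadCharC_apply, -quadraticChar_apply, quadraticChar_neg_one_iff_not_isSquare.2 hs]⟩)
  rcases hcases x with ⟨hx, hχ⟩ | ⟨hx, hx', hχ⟩ | ⟨hx, hx', hχ⟩ <;>
  rcases hcases y with ⟨hy, hη⟩ | ⟨hy, hy', hη⟩ | ⟨hy, hy', hη⟩ <;>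
  rw [hχ, hη] <;> simp [*] <;> norm_num

lemma abs_card_isSquare_isSquare_sub_le [DecidableEq F] (h2 : ringChar F ≠ 2)
    (hι : 3 ≤ Fintype.card ι) {M N : Matrix ι ι F} (hM : M.IsSymm) (hN : N.IsSymm)
    (hMdet : IsUnit M.det) (hNdet : IsUnit N.det) (hMN : ∀ c : F, N ≠ c • M) :
    |4 * ((Finset.univ.filter fun v : ι → F ↦
        (IsSquare (v ⬝ᵥ M *ᵥ v) ∧ v ⬝ᵥ M *ᵥ v ≠ 0) ∧
          IsSquare (v ⬝ᵥ N *ᵥ v) ∧ v ⬝ᵥ N *ᵥ v ≠ 0).card : ℝ) -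
        (Fintype.card F : ℝ) ^ Fintype.card ι| ≤
      (Fintype.card ι + 11) * √(Fintype.card F) ^ (2 * Fintype.card ι - 1) := by
  set E := √(Fintype.card F : ℝ) ^ (2 * Fintype.card ι - 1)
  have hψ := AddChar.FiniteField.primitiveChar_to_Complex_isPrimitive F
  set f : (ι → F) → F := fun v ↦ v ⬝ᵥ M *ᵥ v
  set g : (ι → F) → F := fun v ↦ v ⬝ᵥ N *ᵥ v
  have hA := norm_sum_quadCharC_le h2 hψ (by omega) hM hMdet
  have hB := norm_sum_quadCharC_le h2 hψ (by omega) hN hNdet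
  have hAB := norm_sum_quadCharC_mul_le h2 hψ hι hM hN hMdet hMN
  have hZM := card_quadForm_eq_zero_le h2 hψ (by omega) hM hMdet
  have hZN := card_quadForm_eq_zero_le h2 hψ (by omega) hN hNdet
  set c := (Finset.univ.filter fun v : ι → F ↦
    (IsSquare (f v) ∧ f v ≠ 0) ∧ IsSquare (g v) ∧ g v ≠ 0).card
  set A := ∑ v, quadCharC F (f v)
  set B := ∑ v, quadCharC F (g v)
  set AB := ∑ v, quadCharC F (f v) * quadCharC F (g v)
  have hD : ‖4 * (c : ℂ) - ((Fintype.card F : ℂ) ^ Fintype.card ι + A + B + AB)‖ ≤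
      2 * ((Finset.univ.filter fun v ↦ f v = 0).card +
        (Finset.univ.filter fun v ↦ g v = 0).card) := by
    have h := norm_sum_le_of_le Finset.univ
      fun (v : ι → F) _ ↦ norm_indicator_isSquare_sub_le (f v) (g v)
    rw [Finset.sum_sub_distrib, ← Finset.mul_sum, ← Finset.mul_sum] at h
    simp only [Finset.sum_add_distrib, Finset.sum_boole, Finset.sum_const, Finset.card_univ,
      Fintype.card_fun, nsmul_eq_mul, mul_one, Nat.cast_pow] at h
    exact h
  have heq : (4 * (c : ℂ) - (Fintype.card F : ℂ) ^ Fintype.card ι) =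
      (4 * (c : ℂ) - ((Fintype.card F : ℂ) ^ Fintype.card ι + A + B + AB)) + A + B + AB := by ring
  have hnorm : ‖4 * (c : ℂ) - (Fintype.card F : ℂ) ^ Fintype.card ι‖ ≤
      2 * (2 * E + 2 * E) + E + E + (Fintype.card ι + 1) * E := by
    rw [heq]
    refine (norm_add₃_le ..).trans ?_
    linarith [norm_add_le
      (4 * (c : ℂ) - ((Fintype.card F : ℂ) ^ Fintype.card ι + A + B + AB)) A]
  have hcast : ‖4 * (c : ℂ) - (Fintype.card F : ℂ) ^ Fintype.card ι‖ =
      |4 * (c : ℝ) - (Fintype.card F : ℝ) ^ Fintype.card ι| := by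
    rw [← Real.norm_eq_abs, ← Complex.norm_real]
    push_cast
    rfl
  rw [← hcast]
  linarith

end QuadraticExponentialSums

/-- Remark 1.3(ii): for a fixed odd `n ≥ 3`, the number of points of `ℙ^{n-1}(F_q)` external to
the smooth quadric `{f = 0}` and external to the smooth quadric `{g = 0}` is
`q^{n-1}/4 + O(q^{n-3/2})`, expressed via counts of nonzero vectors. -/
theorem external_external_count (n : ℕ) (hodd : Odd n) (hn : 3 ≤ n) :
    ∃ C : ℝ, 0 < C ∧
      ∀ (q : ℕ) (F : Type) [Field F] [Fintype F],
        Fintype.card F = q → Odd q →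
        ∀ M N : Matrix (Fin n) (Fin n) F,
          M.IsSymm → N.IsSymm → IsUnit M.det → IsUnit N.det →
          (∀ c : F, N ≠ c • M) →
          abs (({v : Fin n → F | v ≠ 0 ∧
                (IsSquare ((-1) ^ ((n - 1) / 2) * M.det * (v ⬝ᵥ M.mulVec v)) ∧
                  (-1) ^ ((n - 1) / 2) * M.det * (v ⬝ᵥ M.mulVec v) ≠ 0) ∧
                (IsSquare ((-1) ^ ((n - 1) / 2) * N.det * (v ⬝ᵥ N.mulVec v)) ∧
                  (-1) ^ ((n - 1) / 2) * N.det * (v ⬝ᵥ N.mulVec v) ≠ 0)}.ncard : ℝ)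
              - ((q : ℝ) - 1) * (q : ℝ) ^ (n - 1) / 4)
            ≤ C * ((q : ℝ) - 1) * (q : ℝ) ^ ((n : ℝ) - 3 / 2) := by
  refine ⟨n + 12, by positivity, fun q F _ _ hq hqodd M N hM hN hMdet hNdet hMN ↦ ?_⟩
  classical
  subst hq
  have h2 : ringChar F ≠ 2 := fun h ↦
    (Nat.not_even_iff_odd.2 hqodd) (Nat.even_iff.2 (FiniteField.even_card_iff_char_two.1 h))
  set a : F := (-1) ^ ((n - 1) / 2) * M.det with ha
  set b : F := (-1) ^ ((n - 1) / 2) * N.det with hb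
  have hunit : IsUnit ((-1 : F) ^ ((n - 1) / 2)) := isUnit_one.neg.pow _
  have ha0 : a ≠ 0 := (hunit.mul hMdet).ne_zero
  have hb0 : b ≠ 0 := (hunit.mul hNdet).ne_zero
  have hsmul (c : F) : b • N ≠ c • a • M := fun h ↦ by
    refine hMN (b⁻¹ * (c * a)) ?_
    rw [mul_smul, mul_smul, ← h, inv_smul_smul₀ hb0]
  have hmain := abs_card_isSquare_isSquare_sub_le (ι := Fin n) h2 (by simpa using hn)
    (hM.smul a) (hN.smul b) (isUnit_det_smul hMdet ha0) (isUnit_det_smul hNdet hb0) hsmul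
  simp only [smul_mulVec, dotProduct_smul, smul_eq_mul, Fintype.card_fin] at hmain
  rw [Set.ncard_eq_toFinset_card', Set.toFinset_ofPred]
  have hfilter : (Finset.univ.filter fun v : Fin n → F ↦ v ≠ 0 ∧
      (IsSquare (a * (v ⬝ᵥ M *ᵥ v)) ∧ a * (v ⬝ᵥ M *ᵥ v) ≠ 0) ∧
        IsSquare (b * (v ⬝ᵥ N *ᵥ v)) ∧ b * (v ⬝ᵥ N *ᵥ v) ≠ 0) =
      Finset.univ.filter fun v : Fin n → F ↦
        (IsSquare (a * (v ⬝ᵥ M *ᵥ v)) ∧ a * (v ⬝ᵥ M *ᵥ v) ≠ 0) ∧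
          IsSquare (b * (v ⬝ᵥ N *ᵥ v)) ∧ b * (v ⬝ᵥ N *ᵥ v) ≠ 0 := by
    refine Finset.filter_congr fun v _ ↦ and_iff_right_of_imp fun h hv ↦ h.1.2 ?_
    simp [hv]
  rw [hfilter]
  set c := (Finset.univ.filter fun v : Fin n → F ↦
    (IsSquare (a * (v ⬝ᵥ M *ᵥ v)) ∧ a * (v ⬝ᵥ M *ᵥ v) ≠ 0) ∧
      IsSquare (b * (v ⬝ᵥ N *ᵥ v)) ∧ b * (v ⬝ᵥ N *ᵥ v) ≠ 0).card
  set r := √(Fintype.card F : ℝ) with hr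
  have hr1 : 1 ≤ r := one_le_sqrt_card
  have hq2 : (2 : ℝ) ≤ Fintype.card F := by exact_mod_cast Fintype.one_lt_card (α := F)
  have hrpow : (Fintype.card F : ℝ) ^ ((n : ℝ) - 3 / 2) = r ^ (2 * n - 3) := by
    rw [hr, Real.sqrt_eq_rpow, ← Real.rpow_natCast, ← Real.rpow_mul (by positivity),
      Nat.cast_sub (by omega)]
    congr 1
    push_cast
    ring
  have hE : r ^ (2 * n - 1) = Fintype.card F * r ^ (2 * n - 3) := by
    rw [card_eq_sqrt_card_sq, ← hr, ← pow_add]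
    congr 1
    omega
  have hpow : (Fintype.card F : ℝ) ^ (n - 1) ≤ r ^ (2 * n - 1) := by
    rw [card_eq_sqrt_card_sq, ← hr, ← pow_mul]
    exact pow_le_pow_right₀ hr1 (by omega)
  have hpow_succ : (Fintype.card F : ℝ) ^ n = Fintype.card F * (Fintype.card F : ℝ) ^ (n - 1) := by
    rw [← pow_succ', Nat.sub_add_cancel (by omega)]
  have hpow0 : (0 : ℝ) ≤ (Fintype.card F : ℝ) ^ (n - 1) := by positivity
  have hE0 : 0 ≤ r ^ (2 * n - 3) := by positivity
  have hle : r ^ (2 * n - 1) ≤ 2 * (((Fintype.card F : ℝ) - 1) * r ^ (2 * n - 3)) := by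
    rw [hE]
    nlinarith
  have hfinal : ((n : ℝ) + 12) * r ^ (2 * n - 1) ≤
      ((n : ℝ) + 12) * (2 * (((Fintype.card F : ℝ) - 1) * r ^ (2 * n - 3))) := by gcongr
  have hpos : 0 ≤ ((n : ℝ) + 12) * (((Fintype.card F : ℝ) - 1) * r ^ (2 * n - 3)) :=
    mul_nonneg (by positivity) (mul_nonneg (by linarith) hE0)
  rw [hrpow]
  rw [hpow_succ] at hmain
  rw [abs_le] at hmain ⊢
  constructor <;> nlinarith
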